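/- Let d ≥ 1, s ∈ ℝ, τ ≥ 0, N ≥ 1 a natural number, and q, B ≥ 0. Let g, u, v : ℤ^d → ℝ satisfy: v(n) = 0 and g(n) = 0 for all ‖n‖_∞ > N; ∑_{‖n‖_∞ ≤ N} w_{s−τ}(n)(g(n) − v(n))² ≤ q; ∑_{‖n‖_∞ ≤ N} w_{s−τ}(n)(g(n) − u(n))² ≤ q; and ∑_{n ∈ ℤ^d} w_s(n) u(n)² ≤ B (with the relevant series convergent). Then ∑_{n ∈ ℤ^d} w_{s−τ}(n)(v(n) − u(n))² ≤ 4q + B · N^{−2τ}. -/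

import Mathlib

open scoped BigOperators

/-- Squared Euclidean norm of a lattice point `n ∈ ℤ^d`, viewed in `ℝ^d`. -/
noncomputable def latNormSq {d : ℕ} (n : Fin d → ℤ) : ℝ := ∑ i, ((n i : ℝ)) ^ 2

/-- Sobolev weight `w_r(n) = (1 + ‖n‖₂²)^r`. -/
noncomputable def sobWeight {d : ℕ} (r : ℝ) (n : Fin d → ℤ) : ℝ := (1 + latNormSq n) ^ r

/-- Max (sup) norm `‖n‖_∞` of a lattice point, as a natural number. -/
def supNorm {d : ℕ} (n : Fin d → ℤ) : ℕ := Finset.univ.sup fun i => (n i).natAbs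

theorem one_le_one_add_latNormSq {d : ℕ} (n : Fin d → ℤ) : 1 ≤ 1 + latNormSq n :=
  le_add_of_nonneg_right (Finset.sum_nonneg fun _ _ => sq_nonneg _)

theorem sobWeight_nonneg {d : ℕ} (r : ℝ) (n : Fin d → ℤ) : 0 ≤ sobWeight r n :=
  Real.rpow_nonneg (zero_le_one.trans (one_le_one_add_latNormSq n)) r

theorem supNorm_sq_le_latNormSq {d : ℕ} (n : Fin d → ℤ) {N : ℕ} (hN : N < supNorm n) :
    (N : ℝ) ^ 2 ≤ latNormSq n := by
  obtain ⟨i, -, hi⟩ := Finset.lt_sup_iff.mp hN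
  have habs : (N : ℝ) ≤ |(n i : ℝ)| := by
    rw [← Int.cast_abs, Int.abs_eq_natAbs]
    exact_mod_cast hi.le
  calc (N : ℝ) ^ 2 ≤ |(n i : ℝ)| ^ 2 := by gcongr
    _ = (n i : ℝ) ^ 2 := sq_abs _
    _ ≤ latNormSq n :=
      Finset.single_le_sum (f := fun i => (n i : ℝ) ^ 2) (fun _ _ => sq_nonneg _)
        (Finset.mem_univ i)

theorem finite_setOf_supNorm_le (d N : ℕ) : {n : Fin d → ℤ | supNorm n ≤ N}.Finite := by
  refine (Set.finite_Icc (fun _ : Fin d => -(N : ℤ)) (fun _ => (N : ℤ))).subset fun n hn => ?_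
  have hcoord (i : Fin d) : (n i).natAbs ≤ N :=
    (Finset.le_sup (f := fun i => (n i).natAbs) (Finset.mem_univ i)).trans hn
  exact ⟨fun i => by have := hcoord i; dsimp only; omega,
    fun i => by have := hcoord i; dsimp only; omega⟩

/-- Outside the box of radius `N`, lowering the Sobolev order by `τ` gains `N ^ (-2τ)`. -/
theorem sobWeight_sub_le {d : ℕ} (s : ℝ) {τ : ℝ} (hτ : 0 ≤ τ) {N : ℕ} (hN : 1 ≤ N)
    (n : Fin d → ℤ) (hn : N < supNorm n) :
    sobWeight (s - τ) n ≤ (N : ℝ) ^ (-(2 * τ)) * sobWeight s n := by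
  have hpos : 0 < 1 + latNormSq n := zero_lt_one.trans_le (one_le_one_add_latNormSq n)
  have hNpos : (0 : ℝ) < N := by exact_mod_cast hN
  have hdecay : (1 + latNormSq n) ^ (-τ) ≤ (N : ℝ) ^ (-(2 * τ)) := by
    have hsq : ((N : ℝ) ^ 2) ^ (-τ) = (N : ℝ) ^ (-(2 * τ)) := by
      rw [← Real.rpow_natCast, ← Real.rpow_mul hNpos.le]
      congr 1
      push_cast
      ring
    rw [← hsq]
    exact Real.rpow_le_rpow_of_nonpos (by positivity)
      (by linarith [supNorm_sq_le_latNormSq n hn]) (by linarith)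
  unfold sobWeight
  rw [show s - τ = -τ + s by ring, Real.rpow_add hpos]
  gcongr

/-- distance bound between an element of the finite-dimensional
conformal adversarial set and the true spectrum. -/
theorem finite_adversary_distance_bound (d : ℕ) (hd : 1 ≤ d) (s τ : ℝ) (hτ : 0 ≤ τ)
    (N : ℕ) (hN : 1 ≤ N) (q B : ℝ) (hq : 0 ≤ q) (hB : 0 ≤ B)
    (g u v : (Fin d → ℤ) → ℝ)
    (hv0 : ∀ n : Fin d → ℤ, N < supNorm n → v n = 0)
    (hg0 : ∀ n : Fin d → ℤ, N < supNorm n → g n = 0)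
    (hscore_v : ∑' n : {n : Fin d → ℤ // supNorm n ≤ N},
        sobWeight (s - τ) n.1 * (g n.1 - v n.1) ^ 2 ≤ q)
    (hscore_u : ∑' n : {n : Fin d → ℤ // supNorm n ≤ N},
        sobWeight (s - τ) n.1 * (g n.1 - u n.1) ^ 2 ≤ q)
    (husum : Summable fun n : Fin d → ℤ => sobWeight s n * u n ^ 2)
    (hubound : ∑' n : Fin d → ℤ, sobWeight s n * u n ^ 2 ≤ B) :
    ∑' n : Fin d → ℤ, sobWeight (s - τ) n * (v n - u n) ^ 2
      ≤ 4 * q + B * (N : ℝ) ^ (-(2 * τ)) := by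
  set S : Set (Fin d → ℤ) := {n | supNorm n ≤ N}
  have hfin : S.Finite := finite_setOf_supNorm_le d N
  set a : (Fin d → ℤ) → ℝ := fun n => sobWeight (s - τ) n * (g n - v n) ^ 2 with ha
  set b : (Fin d → ℤ) → ℝ := fun n => sobWeight (s - τ) n * (g n - u n) ^ 2 with hb
  set c : (Fin d → ℤ) → ℝ := fun n => sobWeight s n * u n ^ 2 with hc
  have hsum_ind (f : (Fin d → ℤ) → ℝ) : Summable (S.indicator f) :=
    summable_of_hasFiniteSupport (hfin.subset Set.support_indicator_subset)
  have hA : ∑' n, S.indicator a n ≤ q := (tsum_subtype S a).symm.trans_le hscore_v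
  have hB' : ∑' n, S.indicator b n ≤ q := (tsum_subtype S b).symm.trans_le hscore_u
  have hK : (0 : ℝ) ≤ (N : ℝ) ^ (-(2 * τ)) := by positivity
  have hbound (n : Fin d → ℤ) : sobWeight (s - τ) n * (v n - u n) ^ 2 ≤
      2 * S.indicator a n + 2 * S.indicator b n + (N : ℝ) ^ (-(2 * τ)) * c n := by
    by_cases hn : n ∈ S
    · rw [Set.indicator_of_mem hn, Set.indicator_of_mem hn]
      have hcn : 0 ≤ (N : ℝ) ^ (-(2 * τ)) * c n :=
        mul_nonneg hK (mul_nonneg (sobWeight_nonneg s n) (sq_nonneg _))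
      have hsq : (v n - u n) ^ 2 ≤ 2 * (g n - v n) ^ 2 + 2 * (g n - u n) ^ 2 := by
        linarith [sq_nonneg ((g n - v n) + (g n - u n)),
          show (v n - u n) ^ 2 + ((g n - v n) + (g n - u n)) ^ 2 =
            2 * (g n - v n) ^ 2 + 2 * (g n - u n) ^ 2 by ring]
      have hmul := mul_le_mul_of_nonneg_left hsq (sobWeight_nonneg (s - τ) n)
      simp only [ha, hb]
      linarith
    · rw [Set.indicator_of_notMem hn, Set.indicator_of_notMem hn]
      have hlt : N < supNorm n := not_le.mp hn
      have hmul := mul_le_mul_of_nonneg_right (sobWeight_sub_le s hτ hN n hlt) (sq_nonneg (u n))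
      rw [hv0 n hlt]
      simp only [hc]
      linarith
  have hsum₁ := ((hsum_ind a).mul_left 2).add ((hsum_ind b).mul_left 2)
  have hsum₂ := husum.mul_left ((N : ℝ) ^ (-(2 * τ)))
  have hsum := hsum₁.add hsum₂
  have hle := (hsum.of_nonneg_of_le
    (fun n => mul_nonneg (sobWeight_nonneg _ n) (sq_nonneg _)) hbound).tsum_le_tsum hbound hsum
  rw [hsum₁.tsum_add hsum₂, ((hsum_ind a).mul_left 2).tsum_add ((hsum_ind b).mul_left 2),
    tsum_mul_left, tsum_mul_left, tsum_mul_left] at hle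
  have hC := mul_le_mul_of_nonneg_left hubound hK
  linarith
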